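/- Let X be a real random variable with a unimodal and symmetric distribution with mean μ and finite variance σ² > 0. Then for any r ≥ 0, Prob(|X − μ| ≤ r) ≥ (r/σ) / (r/σ + √3). -/

import Mathlib

open MeasureTheory ProbabilityTheory Real

/-- A real distribution is unimodal with mode `m`: its CDF is convex before the mode
and concave after the mode. -/
def UnimodalWithMode (μ : Measure ℝ) (m : ℝ) : Prop :=
  ConvexOn ℝ (Set.Iio m) (fun x => (μ (Set.Iic x)).toReal) ∧
  ConcaveOn ℝ (Set.Ici m) (fun x => (μ (Set.Iic x)).toReal)

/-- A real distribution is symmetric about `m`. -/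
def SymmetricAbout (μ : Measure ℝ) (m : ℝ) : Prop :=
  ∀ r : ℝ, μ (Set.Iic (m - r)) = μ (Set.Ici (m + r))

theorem ConcaveOn.exists_forall_le_add_mul_sub {s : Set ℝ} {f : ℝ → ℝ} {x a b : ℝ}
    (hf : ConcaveOn ℝ s f) (hx : x ∈ s) (ha : a ∈ s) (hax : a < x) (hb : b ∈ s) (hxb : x < b) :
    ∃ c, ∀ t ∈ s, f t ≤ f x + c * (t - x) := by
  obtain ⟨c, hc₁, hc₂⟩ := exists_between_of_forall_le
    (s := Set.image (fun t => (f t - f x) / (t - x)) {t | t ∈ s ∧ x < t})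
    (t := Set.image (fun t => (f x - f t) / (x - t)) {t | t ∈ s ∧ t < x})
    ⟨_, b, ⟨hb, hxb⟩, rfl⟩ ⟨_, a, ⟨ha, hax⟩, rfl⟩ (by
      rintro _ ⟨z, ⟨hz, hxz⟩, rfl⟩ _ ⟨y, ⟨hy, hyx⟩, rfl⟩
      exact hf.slope_anti_adjacent hy hz hyx hxz)
  refine ⟨c, fun t ht => ?_⟩
  rcases lt_trichotomy t x with h | rfl | h
  · have h' := hc₂ ⟨t, ⟨ht, h⟩, rfl⟩
    rw [le_div_iff₀ (sub_pos.2 h)] at h'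
    linarith
  · simp
  · have h' := hc₁ ⟨t, ⟨ht, h⟩, rfl⟩
    rw [div_le_iff₀ (sub_pos.2 h)] at h'
    linarith

/-- If the tail `P(t < Y)` of a nonnegative `Y` dominates `a - c * t` on `(0, T]`, then the second
moment of `Y` is at least `∫ t in 0..T, (a - c * t) * (2 * t)`. -/
theorem le_integral_sq_of_forall_tail_le {Ω : Type*} [MeasurableSpace Ω] {P : Measure Ω}
    [IsFiniteMeasure P] {Y : Ω → ℝ} (hY : Measurable Y) (hY₀ : ∀ ω, 0 ≤ Y ω)
    (hint : Integrable (fun ω => Y ω ^ 2) P) {a c T : ℝ} (hT : 0 ≤ T)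
    (h : ∀ t ∈ Set.Ioc 0 T, a - c * t ≤ P.real {ω | t < Y ω}) :
    a * T ^ 2 - 2 / 3 * c * T ^ 3 ≤ ∫ ω, Y ω ^ 2 ∂P := by
  have hsq : 0 ≤ ∫ ω, Y ω ^ 2 ∂P := integral_nonneg fun ω => sq_nonneg _
  have hlc := lintegral_comp_eq_lintegral_meas_lt_mul (f := Y) (g := fun t => 2 * t) P
    (.of_forall hY₀) hY.aemeasurable
    (fun t _ => (by fun_prop : Continuous fun t : ℝ => 2 * t).intervalIntegrable _ _)
    (by
      filter_upwards [ae_restrict_mem measurableSet_Ioi] with t ht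
      have : (0 : ℝ) < t := ht
      positivity)
  have hsecond : ENNReal.ofReal (∫ ω, Y ω ^ 2 ∂P) =
      ∫⁻ t in Set.Ioi (0 : ℝ), P {ω | t < Y ω} * ENNReal.ofReal (2 * t) := by
    rw [← hlc, ofReal_integral_eq_lintegral_ofReal hint (.of_forall fun ω => sq_nonneg _)]
    congr 1 with ω
    rw [intervalIntegral.integral_const_mul, integral_id]
    congr 1
    ring
  have hpoly : ∫ t in 0..T, (a - c * t) * (2 * t) = a * T ^ 2 - 2 / 3 * c * T ^ 3 := by
    have hd : ∀ t ∈ Set.uIcc 0 T,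
        HasDerivAt (fun t => a * t ^ 2 - 2 / 3 * c * t ^ 3) ((a - c * t) * (2 * t)) t := by
      intro t _
      have h₁ := ((hasDerivAt_pow 2 t).const_mul a).sub ((hasDerivAt_pow 3 t).const_mul (2 / 3 * c))
      refine h₁.congr_deriv ?_
      norm_num
      ring
    rw [intervalIntegral.integral_eq_sub_of_hasDerivAt hd
      ((by fun_prop : Continuous fun t : ℝ => (a - c * t) * (2 * t)).intervalIntegrable _ _)]
    ring
  have hi : Integrable (fun t : ℝ => (a - c * t) * (2 * t)) (volume.restrict (Set.Ioc 0 T)) :=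
    ((by fun_prop : Continuous fun t : ℝ => (a - c * t) * (2 * t)).integrableOn_Icc).mono_set
      Set.Ioc_subset_Icc_self
  rw [← ENNReal.ofReal_le_ofReal_iff hsq, hsecond, ← hpoly, intervalIntegral.integral_of_le hT]
  calc ENNReal.ofReal (∫ t in Set.Ioc 0 T, (a - c * t) * (2 * t))
      ≤ ENNReal.ofReal (∫⁻ t in Set.Ioc 0 T, ENNReal.ofReal ((a - c * t) * (2 * t))).toReal := by
        apply ENNReal.ofReal_le_ofReal
        rw [integral_eq_lintegral_pos_part_sub_lintegral_neg_part hi]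
        exact sub_le_self _ ENNReal.toReal_nonneg
    _ ≤ ∫⁻ t in Set.Ioc 0 T, ENNReal.ofReal ((a - c * t) * (2 * t)) := ENNReal.ofReal_toReal_le
    _ ≤ ∫⁻ t in Set.Ioc 0 T, P {ω | t < Y ω} * ENNReal.ofReal (2 * t) := by
        refine setLIntegral_mono' measurableSet_Ioc fun t ht => ?_
        rw [ENNReal.ofReal_mul' (by linarith [ht.1])]
        gcongr
        exact (ENNReal.ofReal_le_ofReal (h t ht)).trans ENNReal.ofReal_toReal_le
    _ ≤ _ := lintegral_mono_set Set.Ioc_subset_Ioi_self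

/-- If the distribution function of a nonnegative `Y` is concave on `[0, ∞)`, then
`P(Y ≤ r) ≥ r / (r + √3 * s)`, where `s` is the root of the second moment of `Y`; stated here
without division or square roots. -/
theorem mul_one_sub_cdf_sq_le_of_concaveOn {Ω : Type*} [MeasurableSpace Ω] {P : Measure Ω}
    [IsProbabilityMeasure P] {Y : Ω → ℝ} (hY : Measurable Y) (hY₀ : ∀ ω, 0 ≤ Y ω)
    (hint : Integrable (fun ω => Y ω ^ 2) P)
    (hG : ConcaveOn ℝ (Set.Ici 0) fun t => P.real {ω | Y ω ≤ t}) {r : ℝ} (hr : 0 < r) :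
    (r * (1 - P.real {ω | Y ω ≤ r})) ^ 2 ≤
      3 * (∫ ω, Y ω ^ 2 ∂P) * P.real {ω | Y ω ≤ r} ^ 2 := by
  obtain ⟨c, hc⟩ := hG.exists_forall_le_add_mul_sub (x := r) (a := 0) (b := r + 1)
    hr.le Set.self_mem_Ici hr (by simp; linarith) (by linarith)
  set p := P.real {ω | Y ω ≤ r}
  set S := ∫ ω, Y ω ^ 2 ∂P
  have hp₀ : 0 ≤ p := measureReal_nonneg
  have hp₁ : p ≤ 1 := measureReal_le_one
  have hcr : c * r ≤ p := by
    have h₀ := hc 0 Set.self_mem_Ici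
    have : 0 ≤ P.real {ω | Y ω ≤ 0} := measureReal_nonneg
    linarith
  have hc₀ : 0 ≤ c := by
    have h₁ := hc (r + 1) (by simp; linarith)
    have : p ≤ P.real {ω | Y ω ≤ r + 1} :=
      measureReal_mono fun ω hω => by simp only [Set.mem_ofPred_eq] at *; linarith
    linarith
  have key : ∀ T : ℝ, 0 ≤ T → (1 - p + c * r) * T ^ 2 - 2 / 3 * c * T ^ 3 ≤ S := by
    intro T hT
    refine le_integral_sq_of_forall_tail_le hY hY₀ hint hT fun t ht => ?_
    have h₁ := hc t ht.1.le
    have h₂ : P.real {ω | t < Y ω} = 1 - P.real {ω | Y ω ≤ t} := by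
      rw [← probReal_compl_eq_one_sub (measurableSet_le hY measurable_const)]
      congr 1 with ω
      simp
    linarith
  rcases hp₀.eq_or_lt with h0 | hpos
  · have hcz : c = 0 := by nlinarith
    have hS₀ : 0 ≤ S := integral_nonneg fun ω => sq_nonneg _
    have := key (S + 1) (by linarith)
    rw [← h0, hcz] at this
    nlinarith
  · have h₁ := key (r / p) (by positivity)
    have h₂ : (1 - p + c * r) * (r / p) ^ 2 - 2 / 3 * c * (r / p) ^ 3 =
        r ^ 2 * (3 * (1 - p + c * r) * p - 2 * (c * r)) / (3 * p ^ 3) := by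
      field_simp
    rw [h₂, div_le_iff₀ (by positivity)] at h₁
    have hu : 0 ≤ c * r := by positivity
    have h₃ : (1 - p) ^ 2 * p ≤ 3 * (1 - p + c * r) * p - 2 * (c * r) := by
      nlinarith [mul_nonneg (sub_nonneg.2 hp₁) hpos.le, mul_nonneg (sub_nonneg.2 hp₁) hu,
        mul_nonneg (sub_nonneg.2 hp₁) (sub_nonneg.2 hcr),
        mul_nonneg (mul_nonneg (sub_nonneg.2 hp₁) hpos.le) hpos.le]
    have h₄ : r ^ 2 * ((1 - p) ^ 2 * p) ≤ S * (3 * p ^ 3) :=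
      (mul_le_mul_of_nonneg_left h₃ (sq_nonneg r)).trans h₁
    refine le_of_mul_le_mul_right ?_ hpos
    linarith

theorem SymmetricAbout.measure_Iio_eq_measure_Ioi {ν : Measure ℝ} {m : ℝ}
    (h : SymmetricAbout ν m) (t : ℝ) : ν (Set.Iio (m - t)) = ν (Set.Ioi (m + t)) := by
  have hu : ∀ n : ℕ, (0 : ℝ) < 1 / (n + 1) := fun n => Nat.one_div_pos_of_nat
  have h₁ : Set.Iio (m - t) = ⋃ n : ℕ, Set.Iic (m - (t + 1 / (n + 1))) := by
    ext x
    simp only [Set.mem_Iio, Set.mem_iUnion, Set.mem_Iic]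
    constructor
    · intro hx
      obtain ⟨n, hn⟩ := exists_nat_one_div_lt (sub_pos.2 hx)
      exact ⟨n, by linarith⟩
    · rintro ⟨n, hn⟩
      linarith [hu n]
  have h₂ : Set.Ioi (m + t) = ⋃ n : ℕ, Set.Ici (m + (t + 1 / (n + 1))) := by
    ext x
    simp only [Set.mem_Ioi, Set.mem_iUnion, Set.mem_Ici]
    constructor
    · intro hx
      obtain ⟨n, hn⟩ := exists_nat_one_div_lt (sub_pos.2 hx)
      exact ⟨n, by linarith⟩
    · rintro ⟨n, hn⟩
      linarith [hu n]
  have hle : ∀ i j : ℕ, i ≤ j → (1 : ℝ) / (j + 1) ≤ 1 / (i + 1) := fun i j hij =>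
    Nat.one_div_le_one_div hij
  rw [h₁, h₂, Monotone.measure_iUnion, Monotone.measure_iUnion]
  · simp only [h (t + _)]
  · exact fun i j hij => Set.Ici_subset_Ici.2 (by linarith [hle i j hij])
  · exact fun i j hij => Set.Iic_subset_Iic.2 (by linarith [hle i j hij])

theorem SymmetricAbout.measureReal_abs_sub_le {ν : Measure ℝ} [IsProbabilityMeasure ν] {m : ℝ}
    (h : SymmetricAbout ν m) {t : ℝ} (ht : 0 ≤ t) :
    ν.real {x | |x - m| ≤ t} = 2 * ν.real (Set.Iic (m + t)) - 1 := by
  have h₁ : {x | |x - m| ≤ t} = Set.Iic (m + t) \ Set.Iio (m - t) := by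
    ext x
    simp only [Set.mem_ofPred_eq, abs_le, Set.mem_sdiff, Set.mem_Iic, Set.mem_Iio, not_lt]
    constructor <;> rintro ⟨h₁, h₂⟩ <;> constructor <;> linarith
  have h₂ : ν.real (Set.Iio (m - t)) = 1 - ν.real (Set.Iic (m + t)) := by
    rw [← probReal_compl_eq_one_sub measurableSet_Iic, Set.compl_Iic]
    exact congrArg ENNReal.toReal (h.measure_Iio_eq_measure_Ioi t)
  rw [h₁, measureReal_sdiff (fun x hx => by simp only [Set.mem_Iio, Set.mem_Iic] at *; linarith)
    measurableSet_Iio, h₂]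
  ring

/-- Gauss-inequality consequence: for a unimodal symmetric random variable `X` with
mean `μ` and standard deviation `σ > 0`, `Prob(|X − μ| ≤ r) ≥ (r/σ)/(r/σ + √3)`. -/
theorem stmt0
    {Ω : Type*} [MeasureSpace Ω] [IsProbabilityMeasure (ℙ : Measure Ω)]
    (X : Ω → ℝ) (hX : Measurable X) (μ σ : ℝ) (hσ : 0 < σ)
    (hmean : ∫ ω, X ω = μ)
    (hvar : ∫ ω, (X ω - μ) ^ 2 = σ ^ 2)
    (huni : UnimodalWithMode (Measure.map X ℙ) μ)
    (hsym : SymmetricAbout (Measure.map X ℙ) μ)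
    (r : ℝ) (hr : 0 ≤ r) :
    (r / σ) / (r / σ + Real.sqrt 3) ≤ (ℙ {ω | |X ω - μ| ≤ r}).toReal := by
  rcases hr.eq_or_lt with rfl | hr
  · simp
  have : IsProbabilityMeasure (Measure.map X ℙ) := Measure.isProbabilityMeasure_map hX.aemeasurable
  have hY : Measurable fun ω => |X ω - μ| := by fun_prop
  have hint : Integrable fun ω => (X ω - μ) ^ 2 := by
    by_contra hn
    rw [integral_undef hn] at hvar
    exact (pow_pos hσ 2).ne hvar
  have hcdf : ∀ t, 0 ≤ t → (ℙ : Measure Ω).real {ω | |X ω - μ| ≤ t} =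
      2 * ((Measure.map X ℙ) (Set.Iic (μ + t))).toReal - 1 := by
    intro t ht
    rw [← measureReal_def, ← hsym.measureReal_abs_sub_le ht, map_measureReal_apply hX]
    · rfl
    · exact measurableSet_le (by fun_prop) measurable_const
  have hG : ConcaveOn ℝ (Set.Ici 0) fun t => (ℙ : Measure Ω).real {ω | |X ω - μ| ≤ t} := by
    refine ⟨convex_Ici 0, fun x hx y hy a b ha hb hab => ?_⟩
    have hx' : 0 ≤ x := hx
    have hy' : 0 ≤ y := hy
    have h := huni.2.2 (x := μ + x) (y := μ + y) (by simpa) (by simpa) ha hb hab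
    have heq : a * (μ + x) + b * (μ + y) = μ + (a * x + b * y) := by
      linear_combination μ * hab
    simp only [smul_eq_mul, heq] at h ⊢
    rw [hcdf x hx', hcdf y hy', hcdf _ (by positivity)]
    linarith
  have h := mul_one_sub_cdf_sq_le_of_concaveOn hY (fun ω => abs_nonneg _)
    (by simpa only [sq_abs] using hint) hG hr
  simp only [sq_abs, hvar] at h
  rw [← measureReal_def]
  set p := (ℙ : Measure Ω).real {ω | |X ω - μ| ≤ r}
  have hp : 0 ≤ p := measureReal_nonneg
  have h₃ : √3 ^ 2 = (3 : ℝ) := Real.sq_sqrt (by norm_num)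
  have h' : r * (1 - p) ≤ √3 * σ * p := by
    refine (abs_le_of_sq_le_sq' ?_ (by positivity)).2
    rw [mul_pow (√3 * σ), mul_pow √3, h₃]
    exact h
  have hlhs : r / σ / (r / σ + √3) = r / (r + √3 * σ) := by
    field_simp
  rw [hlhs, div_le_iff₀ (by positivity)]
  linarith
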